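/- arXiv:1705.01720 — 6 statements merged into one kernel-verified Lean document; each statement's English description precedes it below -/
import Mathlib

section
/- Let H ⊆ ℝ^n be a finite set of size |H| = m ≥ 1. Then the number of distinct sign patterns realized by points of ℝ^n on H satisfies |{A_H(x) : x ∈ ℝ^n}| ≤ (2em)^n. -/
open Finset

namespace LDT

/-- The standard inner product on `ℝ^n`. -/
def ip {n : ℕ} (x h : Fin n → ℝ) : ℝ := ∑ i, x i * h i

/-- `S` infers `h` at `x`: the sign of `⟨x,h⟩` is determined by the signs of `⟨x,v⟩` for
`v ∈ S ∪ (S - S)`, i.e. every `x'` with the same sign pattern as `x` on `S ∪ (S-S)` gives the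
same sign on `h`. -/
def Infers {n : ℕ} (S : Finset (Fin n → ℝ)) (x h : Fin n → ℝ) : Prop :=
  ∀ x' : Fin n → ℝ,
    (∀ v ∈ S, SignType.sign (ip x' v) = SignType.sign (ip x v)) →
    (∀ v ∈ S, ∀ w ∈ S, SignType.sign (ip x' (v - w)) = SignType.sign (ip x (v - w))) →
    SignType.sign (ip x' h) = SignType.sign (ip x h)

/-- `H` has inference dimension at most `d`: every subset `S ⊆ H` of size at least `d` contains,
for every `x`, an element `h` inferred by `S \ {h}` at `x`. -/
def InfProp {n : ℕ} (H : Finset (Fin n → ℝ)) (d : ℕ) : Prop :=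
  ∀ S ⊆ H, d ≤ S.card → ∀ x : Fin n → ℝ, ∃ h ∈ S, Infers (S.erase h) x h

section SignVectors

variable {ι V : Type*} [AddCommGroup V] [Module ℝ V]

open Classical in
/-- The sign vector of `x` on the functionals `L i`, `i ∈ s`, extended by `0` outside `s`. -/
noncomputable def signVec (L : ι → V →ₗ[ℝ] ℝ) (s : Finset ι) (x : V) : ι → SignType :=
  fun i => if i ∈ s then SignType.sign (L i x) else 0

open Classical in
lemma signVec_insert (L : ι → V →ₗ[ℝ] ℝ) (s : Finset ι) (a : ι) (x : V) :
    signVec L (insert a s) x = Function.update (signVec L s x) a (SignType.sign (L a x)) := by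
  funext i
  by_cases h : i = a
  · subst h
    simp [signVec]
  · simp [signVec, h]

lemma sign_pos_combination {u v p q : ℝ} (hp : 0 < p) (hq : 0 < q)
    (h : SignType.sign u = SignType.sign v) :
    SignType.sign (p * u + q * v) = SignType.sign u := by
  rcases lt_trichotomy u 0 with hu | hu | hu
  · rw [sign_neg hu] at h ⊢
    have hv : v < 0 := sign_eq_neg_one_iff.1 h.symm
    exact sign_neg (by nlinarith [mul_pos hp (neg_pos.2 hu), mul_pos hq (neg_pos.2 hv)])
  · subst hu
    rw [sign_zero] at h
    have hv : v = 0 := sign_eq_zero_iff.1 h.symm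
    simp [hv]
  · rw [sign_pos hu] at h ⊢
    have hv : 0 < v := sign_eq_one_iff.1 h.symm
    exact sign_pos (by positivity)

/-- A sign vector realized in `W` on both open sides of a hyperplane is realized on it. -/
lemma signVec_inter_subset (L : ι → V →ₗ[ℝ] ℝ) (s : Finset ι) (l : V →ₗ[ℝ] ℝ)
    (W : Submodule ℝ V) :
    signVec L s '' {x | x ∈ W ∧ 0 < l x} ∩ signVec L s '' {x | x ∈ W ∧ l x < 0} ⊆
      signVec L s '' (W ⊓ LinearMap.ker l : Submodule ℝ V) := by
  rintro _ ⟨⟨x, ⟨hxW, hx⟩, rfl⟩, ⟨y, ⟨hyW, hy⟩, hxy⟩⟩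
  refine ⟨(-l y) • x + l x • y, ⟨W.add_mem (W.smul_mem _ hxW) (W.smul_mem _ hyW), ?_⟩, ?_⟩
  · simp only [SetLike.mem_coe, LinearMap.mem_ker, map_add, map_smul, smul_eq_mul]
    ring
  · funext i
    have hi := congrFun hxy i
    by_cases his : i ∈ s
    · simp only [signVec, his, if_true, map_add, map_smul, smul_eq_mul] at hi ⊢
      exact sign_pos_combination (neg_pos.2 hy) hx hi.symm
    · simp [signVec, his]

lemma finite_signVec_image (L : ι → V →ₗ[ℝ] ℝ) (s : Finset ι) (X : Set V) :
    (signVec L s '' X).Finite := by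
  classical
  refine Set.Finite.subset ?_ (Set.image_subset_range _ _)
  induction s using Finset.induction_on with
  | empty =>
    refine (Set.finite_singleton (fun _ => 0)).subset ?_
    rintro _ ⟨x, rfl⟩
    funext i
    simp [signVec]
  | insert a s _ ih =>
    refine (Set.Finite.image2 (fun σ t => Function.update σ a t) ih
      (Set.toFinite (Set.univ : Set SignType))).subset ?_
    rintro _ ⟨x, rfl⟩
    exact ⟨_, ⟨x, rfl⟩, _, Set.mem_univ _, (signVec_insert L s a x).symm⟩

open Classical in
lemma ncard_signVec_insert_le (L : ι → V →ₗ[ℝ] ℝ) (s : Finset ι) (a : ι) (W : Submodule ℝ V) :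
    (signVec L (insert a s) '' (W : Set V)).ncard ≤
      (signVec L s '' (W : Set V)).ncard +
        2 * (signVec L s '' (W ⊓ LinearMap.ker (L a) : Submodule ℝ V)).ncard := by
  set Z := signVec L s '' (W ⊓ LinearMap.ker (L a) : Submodule ℝ V)
  set P := signVec L s '' {x | x ∈ W ∧ 0 < L a x}
  set N := signVec L s '' {x | x ∈ W ∧ L a x < 0}
  have hZf : Z.Finite := finite_signVec_image L s _
  have hPf : P.Finite := finite_signVec_image L s _
  have hNf : N.Finite := finite_signVec_image L s _
  have hsub : signVec L (insert a s) '' (W : Set V) ⊆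
      (fun σ => Function.update σ a 0) '' Z ∪
        ((fun σ => Function.update σ a 1) '' P ∪ (fun σ => Function.update σ a (-1)) '' N) := by
    rintro _ ⟨x, hx, rfl⟩
    rw [signVec_insert]
    rcases lt_trichotomy (L a x) 0 with h | h | h
    · exact Or.inr (Or.inr ⟨_, ⟨x, ⟨hx, h⟩, rfl⟩, by rw [sign_neg h]⟩)
    · exact Or.inl ⟨_, ⟨x, ⟨hx, h⟩, rfl⟩, by rw [h, sign_zero]⟩
    · exact Or.inr (Or.inl ⟨_, ⟨x, ⟨hx, h⟩, rfl⟩, by rw [sign_pos h]⟩)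
  have h1 := Set.ncard_le_ncard hsub
    ((hZf.image _).union ((hPf.image _).union (hNf.image _)))
  have h2 := Set.ncard_union_le ((fun σ => Function.update σ a 0) '' Z)
    ((fun σ => Function.update σ a 1) '' P ∪ (fun σ => Function.update σ a (-1)) '' N)
  have h3 := Set.ncard_union_le ((fun σ => Function.update σ a 1) '' P)
    ((fun σ => Function.update σ a (-1)) '' N)
  have hZ := Set.ncard_image_le (f := fun σ => Function.update σ a 0) hZf
  have hPc := Set.ncard_image_le (f := fun σ => Function.update σ a 1) hPf
  have hNc := Set.ncard_image_le (f := fun σ => Function.update σ a (-1)) hNf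
  have h4 := Set.ncard_union_add_ncard_inter P N hPf hNf
  have h5 : (P ∩ N).ncard ≤ Z.ncard :=
    Set.ncard_le_ncard (signVec_inter_subset L s (L a) W) hZf
  have h6 : (P ∪ N).ncard ≤ (signVec L s '' (W : Set V)).ncard := by
    refine Set.ncard_le_ncard ?_ (finite_signVec_image L s _)
    exact Set.union_subset (Set.image_mono fun x hx => hx.1) (Set.image_mono fun x hx => hx.1)
  omega

/-- The number of sign vectors of `s` on a `d`-dimensional subspace is at most `(2|s|+1)^d`. -/
theorem ncard_signVec_le [FiniteDimensional ℝ V] (L : ι → V →ₗ[ℝ] ℝ) (s : Finset ι)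
    (W : Submodule ℝ V) :
    (signVec L s '' (W : Set V)).ncard ≤ (2 * s.card + 1) ^ Module.finrank ℝ W := by
  classical
  induction s using Finset.induction_on generalizing W with
  | empty =>
    rw [Finset.card_empty, mul_zero, zero_add, one_pow,
      ← Set.ncard_singleton (fun _ : ι => (0 : SignType))]
    refine Set.ncard_le_ncard ?_
    rintro _ ⟨x, -, rfl⟩
    funext i
    simp [signVec]
  | insert a s ha ih =>
    rw [Finset.card_insert_of_notMem ha]
    by_cases hW : W ≤ LinearMap.ker (L a)
    · have heq : signVec L (insert a s) '' (W : Set V) = signVec L s '' (W : Set V) := by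
        refine Set.image_congr fun x hx => ?_
        have hx0 : L a x = 0 := hW hx
        rw [signVec_insert, hx0, sign_zero, Function.update_eq_self_iff]
        simp [signVec, ha]
      rw [heq]
      exact (ih W).trans (Nat.pow_le_pow_left (by omega) _)
    · have hlt : Module.finrank ℝ (W ⊓ LinearMap.ker (L a) : Submodule ℝ V) <
          Module.finrank ℝ W :=
        Submodule.finrank_lt_finrank_of_lt (inf_lt_left.2 hW)
      obtain ⟨d, hd⟩ : ∃ d, Module.finrank ℝ W = d + 1 :=
        ⟨_, (Nat.succ_pred_eq_of_pos (by omega)).symm⟩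
      have hW' := ih W
      have hK := (ih (W ⊓ LinearMap.ker (L a))).trans
        (Nat.pow_le_pow_right (by omega : 0 < 2 * s.card + 1) (by omega : _ ≤ d))
      rw [hd] at hW' ⊢
      calc _ ≤ _ := ncard_signVec_insert_le L s a W
        _ ≤ (2 * s.card + 1) ^ (d + 1) + 2 * (2 * s.card + 1) ^ d := by omega
        _ = (2 * s.card + 1) ^ d * (2 * (s.card + 1) + 1) := by ring
        _ ≤ (2 * (s.card + 1) + 1) ^ d * (2 * (s.card + 1) + 1) := by gcongr; omega
        _ = _ := (pow_succ _ _).symm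

end SignVectors

/-- The functional `x ↦ ⟨x, h⟩`. -/
def ipLinear {n : ℕ} (h : Fin n → ℝ) : (Fin n → ℝ) →ₗ[ℝ] ℝ where
  toFun x := ip x h
  map_add' x y := by simp [ip, add_mul, Finset.sum_add_distrib]
  map_smul' c x := by simp [ip, mul_assoc, Finset.mul_sum]

/-- Lemma 2.1, cell counting: for a finite set `H ⊆ ℝ^n` of size `m ≥ 1`,
the number of distinct sign patterns `A_H(x) = (sign⟨x,h⟩ : h ∈ H)` realized by points
`x ∈ ℝ^n` is at most `(2em)^n`. -/
theorem cell_count {n : ℕ} (H : Finset (Fin n → ℝ)) (m : ℕ) (hm : H.card = m) (hm1 : 1 ≤ m) :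
    ((Set.range (fun x : Fin n → ℝ => fun h : {v // v ∈ H} => SignType.sign (ip x h.1))).ncard : ℝ)
      ≤ (2 * Real.exp 1 * m) ^ n := by
  have hrange : Set.range (fun x : Fin n → ℝ =>
      fun h : {v // v ∈ H} => SignType.sign (ip x h.1)) =
      (fun σ => fun h : {v // v ∈ H} => σ h.1) ''
        (signVec ipLinear H '' ((⊤ : Submodule ℝ (Fin n → ℝ)) : Set (Fin n → ℝ))) := by
    rw [Submodule.top_coe, Set.image_univ, ← Set.range_comp]
    congr 1
    funext x h
    simp only [signVec, Function.comp_apply, h.2, if_true]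
    rfl
  have hcard := (Set.ncard_image_le (f := fun σ => fun h : {v // v ∈ H} => σ h.1)
    (finite_signVec_image ipLinear H ((⊤ : Submodule ℝ (Fin n → ℝ)) : Set (Fin n → ℝ)))).trans
      (ncard_signVec_le ipLinear H ⊤)
  rw [← hrange, finrank_top, Module.finrank_fin_fun, hm] at hcard
  have hm' : (1 : ℝ) ≤ m := by exact_mod_cast hm1
  have he : (2 : ℝ) ≤ Real.exp 1 := by linarith [Real.add_one_le_exp (1 : ℝ)]
  calc _ ≤ (((2 * m + 1) ^ n : ℕ) : ℝ) := by exact_mod_cast hcard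
    _ = (2 * (m : ℝ) + 1) ^ n := by push_cast; rfl
    _ ≤ _ := by
      gcongr
      nlinarith

end LDT
end

section
/- There is a universal constant C > 0 such that for all integers n ≥ 1 and w ≥ 2, the set H = {h ∈ ℤ^n : ‖h‖₁ ≤ w} (viewed as a subset of ℝ^n) has inference dimension at most C·n·log₂(w). -/
open Finset

namespace LDT

/-- The set `{h ∈ ℤ^n : ‖h‖₁ ≤ w}`, viewed as a finite subset of `ℝ^n`. -/
noncomputable def L1Ball (n w : ℕ) : Finset (Fin n → ℝ) :=
  ((Fintype.piFinset (fun _ : Fin n => Finset.Icc (-(w : ℤ)) (w : ℤ))).filter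
    (fun h => ∑ i, |h i| ≤ (w : ℤ))).image (fun h i => ((h i : ℤ) : ℝ))

/-- The number of integer points of `ℓ₁`-norm at most `q * n` in dimension `n` is at most
`(6 * (q + 1)) ^ n`. -/
lemma card_l1_le {n q : ℕ} (hq : 0 < q) (F : Finset (Fin n → ℤ))
    (hF : ∀ v ∈ F, ∑ i, |v i| ≤ (q * n : ℕ)) : F.card ≤ (6 * (q + 1)) ^ n := by
  set R := q * n with hR
  set t : ℝ := q / (q + 1) with ht
  have hq0 : (0 : ℝ) < q := by exact_mod_cast hq
  have ht0 : 0 < t := by positivity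
  have ht1 : t < 1 := by rw [ht, div_lt_one (by positivity)]; linarith
  have hgeom (N : ℕ) : ∑ k ∈ Finset.range N, t ^ k ≤ q + 1 := by
    have h := (summable_geometric_of_lt_one ht0.le ht1).sum_le_tsum (Finset.range N)
      (fun _ _ => by positivity)
    rw [tsum_geometric_of_lt_one ht0.le ht1] at h
    refine h.trans (le_of_eq ?_)
    rw [ht]
    field_simp
    ring
  have hcoord : ∑ k ∈ Finset.Icc (-(R : ℤ)) R, t ^ k.natAbs ≤ 2 * (q + 1) := by
    have hsub : Finset.Icc (-(R : ℤ)) R ⊆ (Finset.range (R + 1)).image (fun k : ℕ => (k : ℤ)) ∪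
        (Finset.range (R + 1)).image (fun k : ℕ => -(k : ℤ)) := by
      intro k hk
      rw [Finset.mem_Icc] at hk
      simp only [Finset.mem_union, Finset.mem_image, Finset.mem_range]
      rcases le_total 0 k with h | h
      · exact Or.inl ⟨k.natAbs, by omega, by omega⟩
      · exact Or.inr ⟨k.natAbs, by omega, by omega⟩
    refine (Finset.sum_le_sum_of_subset_of_nonneg hsub (fun _ _ _ => by positivity)).trans ?_
    have hunion := Finset.sum_union_inter (f := fun k : ℤ => t ^ k.natAbs)
      (s₁ := (Finset.range (R + 1)).image (fun k : ℕ => (k : ℤ)))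
      (s₂ := (Finset.range (R + 1)).image (fun k : ℕ => -(k : ℤ)))
    have hinter : 0 ≤ ∑ k ∈ (Finset.range (R + 1)).image (fun k : ℕ => (k : ℤ)) ∩
        (Finset.range (R + 1)).image (fun k : ℕ => -(k : ℤ)), t ^ k.natAbs :=
      Finset.sum_nonneg fun _ _ => by positivity
    rw [Finset.sum_image (by intro a _ b _ h; simpa using h),
      Finset.sum_image (by intro a _ b _ h; simpa using h)] at hunion
    simp only [Int.natAbs_natCast, Int.natAbs_neg] at hunion
    linarith [hgeom (R + 1)]
  have hsum : (F.card : ℝ) * t ^ R ≤ (2 * (q + 1)) ^ n := by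
    calc (F.card : ℝ) * t ^ R = ∑ v ∈ F, t ^ R := by simp
      _ ≤ ∑ v ∈ F, ∏ i, t ^ (v i).natAbs := by
        refine Finset.sum_le_sum fun v hv => ?_
        rw [Finset.prod_pow_eq_pow_sum]
        refine pow_le_pow_of_le_one ht0.le ht1.le ?_
        have := hF v hv
        zify
        simpa using this
      _ ≤ ∑ v ∈ Fintype.piFinset (fun _ : Fin n => Finset.Icc (-(R : ℤ)) R),
            ∏ i, t ^ (v i).natAbs := by
        refine Finset.sum_le_sum_of_subset_of_nonneg (fun v hv => ?_) (fun _ _ _ => by positivity)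
        rw [Fintype.mem_piFinset]
        intro i
        rw [Finset.mem_Icc, ← abs_le]
        exact (Finset.single_le_sum (f := fun i => |v i|) (fun _ _ => abs_nonneg _)
          (Finset.mem_univ i)).trans (hF v hv)
      _ = ∏ _i : Fin n, ∑ k ∈ Finset.Icc (-(R : ℤ)) R, t ^ k.natAbs := by
        rw [Finset.prod_univ_sum]
      _ ≤ (2 * (q + 1)) ^ n := by
        rw [Finset.prod_const, Finset.card_univ, Fintype.card_fin]
        exact pow_le_pow_left₀ (Finset.sum_nonneg fun _ _ => by positivity) hcoord n
  have hinv : 1 ≤ t ^ q * 3 := by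
    have h1 : ((q + 1 : ℝ) / q) ^ q ≤ 3 := by
      have h2 : (q + 1 : ℝ) / q ≤ Real.exp (1 / q) := by
        have := Real.add_one_le_exp (1 / (q : ℝ))
        refine le_trans (le_of_eq ?_) this
        field_simp
        ring
      calc ((q + 1 : ℝ) / q) ^ q ≤ Real.exp (1 / q) ^ q :=
            pow_le_pow_left₀ (by positivity) h2 q
        _ = Real.exp 1 := by
            rw [← Real.exp_nat_mul]
            congr 1
            field_simp
        _ ≤ 3 := by linarith [Real.exp_one_lt_d9]
    have h3 : t ^ q * ((q + 1 : ℝ) / q) ^ q = 1 := by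
      rw [← mul_pow, ht]
      have : (q : ℝ) / (q + 1) * ((q + 1) / q) = 1 := by field_simp
      rw [this, one_pow]
    rw [← h3]
    exact mul_le_mul_of_nonneg_left h1 (by positivity)
  have hfin : (F.card : ℝ) ≤ (6 * (q + 1)) ^ n := by
    calc (F.card : ℝ) = F.card * 1 := by ring
      _ ≤ F.card * (t ^ q * 3) ^ n :=
        mul_le_mul_of_nonneg_left (one_le_pow₀ hinv) (by positivity)
      _ = F.card * t ^ R * 3 ^ n := by rw [mul_pow, ← pow_mul]; ring
      _ ≤ (2 * (q + 1)) ^ n * 3 ^ n := mul_le_mul_of_nonneg_right hsum (by positivity)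
      _ = (6 * (q + 1)) ^ n := by rw [← mul_pow]; ring
  exact_mod_cast hfin

/-- If two distinct sets of increments of a sequence have the same sum, then some term of the
sequence is its first term plus a nonnegative combination of strictly earlier increments. -/
lemma exists_eq_add_sum_of_sum_eq {M : Type*} [AddCommGroup M] {m : ℕ} (g : ℕ → M)
    {T U : Finset ℕ} (hT : T ⊆ Finset.range m) (hU : U ⊆ Finset.range m) (hTU : T ≠ U)
    (hsum : ∑ i ∈ T, (g (i + 1) - g i) = ∑ i ∈ U, (g (i + 1) - g i)) :
    ∃ p < m, ∃ c : ℕ → ℕ, g (p + 1) = g 0 + ∑ i ∈ Finset.range p, c i • (g (i + 1) - g i) := by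
  have hne : (symmDiff T U).Nonempty := by
    rw [Finset.nonempty_iff_ne_empty]
    intro h
    exact hTU (symmDiff_eq_bot.mp h)
  set p := (symmDiff T U).max' hne with hp
  have hpmem : p ∈ symmDiff T U := Finset.max'_mem _ _
  have hpmax : ∀ i, p < i → (i ∈ T ↔ i ∈ U) := by
    intro i hi
    by_contra hcon
    have : i ∈ symmDiff T U := by
      rw [Finset.mem_symmDiff]; tauto
    exact absurd (Finset.le_max' _ i this) (not_le.mpr hi)
  clear_value p
  clear hp hne
  wlog hpU : p ∈ U ∧ p ∉ T generalizing T U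
  · refine this hU hT hTU.symm hsum.symm (by rwa [symmDiff_comm])
      (fun i hi => (hpmax i hi).symm) ?_
    rw [Finset.mem_symmDiff] at hpmem
    tauto
  obtain ⟨hpU, hpT⟩ := hpU
  have hpm : p < m := Finset.mem_range.mp (hU hpU)
  refine ⟨p, hpm, fun i => if i ∈ T then (if i ∈ U then 1 else 2) else (if i ∈ U then 0 else 1),
    ?_⟩
  set d : ℕ → M := fun i => g (i + 1) - g i with hd
  have hext (V : Finset ℕ) (hV : V ⊆ Finset.range m) :
      ∑ i ∈ V, d i = ∑ i ∈ Finset.range p, (if i ∈ V then d i else 0) +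
        ((if p ∈ V then d p else 0) + ∑ i ∈ Finset.Ico (p + 1) m, if i ∈ V then d i else 0) := by
    rw [← Finset.sum_eq_sum_Ico_succ_bot hpm (fun i => if i ∈ V then d i else 0),
      Finset.sum_range_add_sum_Ico _ hpm.le,
      ← Finset.sum_filter]
    congr 1
    ext i
    simp only [Finset.mem_filter]
    exact ⟨fun h => ⟨hV h, h⟩, fun h => h.2⟩
  have htail : ∑ i ∈ Finset.Ico (p + 1) m, (if i ∈ T then d i else 0) =
      ∑ i ∈ Finset.Ico (p + 1) m, if i ∈ U then d i else 0 := by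
    refine Finset.sum_congr rfl fun i hi => ?_
    rw [Finset.mem_Ico] at hi
    simp only [hpmax i hi.1]
  change ∑ i ∈ T, d i = ∑ i ∈ U, d i at hsum
  rw [hext T hT, hext U hU, htail, if_neg hpT, if_pos hpU, zero_add, ← add_assoc,
    add_left_inj] at hsum
  have htel : ∑ i ∈ Finset.range p, d i = g p - g 0 := Finset.sum_range_sub g p
  have hc : ∑ i ∈ Finset.range p, ((if i ∈ T then (if i ∈ U then 1 else 2)
      else (if i ∈ U then 0 else 1) : ℕ) • d i) + ∑ i ∈ Finset.range p, (if i ∈ U then d i else 0)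
      = ∑ i ∈ Finset.range p, d i + ∑ i ∈ Finset.range p, (if i ∈ T then d i else 0) := by
    rw [← Finset.sum_add_distrib, ← Finset.sum_add_distrib]
    refine Finset.sum_congr rfl fun i _ => ?_
    split_ifs <;> simp [two_nsmul]
  rw [hsum, htel] at hc
  have hdp : d p = g (p + 1) - g p := rfl
  rw [hdp] at hc
  generalize ∑ i ∈ Finset.range p, (if i ∈ U then d i else 0) = a at hc
  rw [show g p - g 0 + (a + (g (p + 1) - g p)) = (g (p + 1) - g 0) + a by abel,
    add_left_inj] at hc
  change _ = g 0 + ∑ i ∈ Finset.range p, (_ : ℕ) • d i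
  rw [hc]
  abel

/-- A long enough sequence of integer vectors of bounded `ℓ₁`-norm has a term which is the first
term plus a nonnegative combination of strictly earlier increments. -/
lemma exists_eq_add_sum_of_l1_le {n w k : ℕ} (hw : 0 < w) (hk : 0 < k)
    (hcard : 6 * (2 * w * k + 1) < 2 ^ k) (hn : 0 < n) (g : ℕ → Fin n → ℤ)
    (hg : ∀ i ≤ n * k, ∑ j, |g i j| ≤ w) :
    ∃ p < n * k, ∃ c : ℕ → ℕ,
      g (p + 1) = g 0 + ∑ i ∈ Finset.range p, c i • (g (i + 1) - g i) := by
  set s : Finset ℕ → Fin n → ℤ := fun T => ∑ i ∈ T, (g (i + 1) - g i) with hs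
  have hle : ((Finset.range (n * k)).powerset.image s).card ≤ (6 * (2 * w * k + 1)) ^ n := by
    refine card_l1_le (by positivity) _ fun v hv => ?_
    obtain ⟨T, hT, rfl⟩ := Finset.mem_image.mp hv
    rw [Finset.mem_powerset] at hT
    calc ∑ j, |s T j| ≤ ∑ j, ∑ i ∈ T, (|g (i + 1) j| + |g i j|) := by
          refine Finset.sum_le_sum fun j _ => ?_
          simp only [hs, Finset.sum_apply, Pi.sub_apply]
          exact (Finset.abs_sum_le_sum_abs _ _).trans
            (Finset.sum_le_sum fun i _ => abs_sub _ _)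
      _ = ∑ i ∈ T, (∑ j, |g (i + 1) j| + ∑ j, |g i j|) := by
          rw [Finset.sum_comm]
          simp only [Finset.sum_add_distrib]
      _ ≤ ∑ i ∈ T, (2 * w : ℤ) := by
          refine Finset.sum_le_sum fun i hi => ?_
          have := Finset.mem_range.mp (hT hi)
          linarith [hg (i + 1) this, hg i this.le]
      _ = T.card * (2 * w) := by simp
      _ ≤ (n * k : ℕ) * (2 * w) := by
          have : T.card ≤ n * k := by simpa using Finset.card_le_card hT
          gcongr
      _ = (2 * w * k * n : ℕ) := by push_cast; ring
  have hlt : ((Finset.range (n * k)).powerset.image s).card <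
      (Finset.range (n * k)).powerset.card := by
    refine hle.trans_lt ?_
    rw [Finset.card_powerset, Finset.card_range, mul_comm n k, pow_mul]
    exact Nat.pow_lt_pow_left hcard hn.ne'
  obtain ⟨T, hT, U, hU, hne, heq⟩ := Finset.exists_ne_map_eq_of_card_lt_of_maps_to hlt
    (fun T hT => Finset.mem_image_of_mem s hT)
  exact exists_eq_add_sum_of_sum_eq g (Finset.mem_powerset.mp hT) (Finset.mem_powerset.mp hU)
    hne heq

/-- A finite set with more than `m` elements has `m + 1` distinct elements listed in increasing
order of a given function. -/
lemma exists_monotone_enumeration {α : Type*} [Nonempty α] (A : Finset α) (φ : α → ℝ) {m : ℕ}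
    (hm : m < A.card) :
    ∃ g : ℕ → α, (∀ i ≤ m, g i ∈ A) ∧ (∀ i ≤ m, ∀ j ≤ m, g i = g j → i = j) ∧
      ∀ i < m, φ (g i) ≤ φ (g (i + 1)) := by
  set e : Fin A.card → α := fun i => (A.equivFin.symm i : α) with he
  have hinj : Function.Injective e :=
    Subtype.val_injective.comp A.equivFin.symm.injective
  set σ := Tuple.sort (φ ∘ e)
  have hmono := Tuple.monotone_sort (φ ∘ e)
  refine ⟨fun i => if h : i < A.card then e (σ ⟨i, h⟩) else Classical.arbitrary α, ?_, ?_, ?_⟩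
  · intro i hi
    have h : i < A.card := by omega
    simp only [h, dif_pos, he]
    exact Subtype.property _
  · intro i hi j hj hij
    have h : i < A.card := by omega
    have h' : j < A.card := by omega
    simp only [h, h', dif_pos] at hij
    simpa using σ.injective (hinj hij)
  · intro i hi
    have h : i < A.card := by omega
    have h' : i + 1 < A.card := by omega
    simp only [h, h', dif_pos]
    exact hmono (show (⟨i, h⟩ : Fin A.card) ≤ ⟨i + 1, h'⟩ by simp)

lemma ip_eq_dotProduct {n : ℕ} (x h : Fin n → ℝ) : ip x h = x ⬝ᵥ h := rfl

lemma ip_neg_left {n : ℕ} (x h : Fin n → ℝ) : ip (-x) h = -ip x h := by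
  simp [ip_eq_dotProduct]

lemma ip_sub {n : ℕ} (x h h' : Fin n → ℝ) : ip x (h - h') = ip x h - ip x h' := by
  simp [ip_eq_dotProduct]

lemma Infers.of_neg {n : ℕ} {S : Finset (Fin n → ℝ)} {x h : Fin n → ℝ}
    (hS : Infers S (-x) h) : Infers S x h := by
  intro x' h1 h2
  have := hS (-x') (fun v hv => by simp only [ip_neg_left, Left.sign_neg, h1 v hv])
    (fun v hv u hu => by simp only [ip_neg_left, Left.sign_neg, h2 v hv u hu])
  simpa only [ip_neg_left, Left.sign_neg, neg_inj] using this

lemma exists_int_of_mem_L1Ball {n w : ℕ} {h : Fin n → ℝ} (hh : h ∈ L1Ball n w) :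
    ∃ z : Fin n → ℤ, (∀ i, (z i : ℝ) = h i) ∧ ∑ i, |z i| ≤ w := by
  obtain ⟨z, hz, rfl⟩ := Finset.mem_image.mp hh
  exact ⟨z, fun _ => rfl, (Finset.mem_filter.mp hz).2⟩

/-- Among sufficiently many vectors of the `ℓ₁`-ball, some vector is, after sorting along `x`, an
earlier vector plus a nonnegative combination of increments between earlier vectors. -/
lemma exists_sorted_combination {n w k : ℕ} (hw : 0 < w) (hk : 0 < k)
    (hcard : 6 * (2 * w * k + 1) < 2 ^ k) (hn : 0 < n) {A : Finset (Fin n → ℝ)}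
    (hA : A ⊆ L1Ball n w) (hAc : n * k < A.card) (x : Fin n → ℝ) :
    ∃ (p : ℕ) (g : ℕ → Fin n → ℝ) (c : ℕ → ℕ), g (p + 1) ∈ A ∧
      (∀ i ≤ p, g i ∈ A.erase (g (p + 1))) ∧ (∀ i < p, ip x (g i) ≤ ip x (g (i + 1))) ∧
      ∀ x', ip x' (g (p + 1)) =
        ip x' (g 0) + ∑ i ∈ Finset.range p, c i * ip x' (g (i + 1) - g i) := by
  obtain ⟨g, hgA, hginj, hgmono⟩ := exists_monotone_enumeration A (ip x) hAc
  have hz : ∀ i, ∃ z : Fin n → ℤ, i ≤ n * k → (∀ j, (z j : ℝ) = g i j) ∧ ∑ j, |z j| ≤ w := by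
    intro i
    by_cases hi : i ≤ n * k
    · obtain ⟨z, hz⟩ := exists_int_of_mem_L1Ball (hA (hgA i hi))
      exact ⟨z, fun _ => hz⟩
    · exact ⟨0, fun h => absurd h hi⟩
  choose z hz using hz
  obtain ⟨p, hp, c, hc⟩ := exists_eq_add_sum_of_l1_le hw hk hcard hn z (fun i hi => (hz i hi).2)
  have hgc : g (p + 1) = g 0 + ∑ i ∈ Finset.range p, (c i : ℝ) • (g (i + 1) - g i) := by
    ext j
    have hj := congrArg (fun v : Fin n → ℤ => ((v j : ℤ) : ℝ)) hc
    simp only [Pi.add_apply, Finset.sum_apply, Pi.smul_apply, Pi.sub_apply, Int.cast_add,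
      Int.cast_sum] at hj
    simp only [nsmul_eq_mul, Int.cast_mul, Int.cast_sub, Int.cast_natCast] at hj
    rw [(hz _ hp).1, (hz 0 (Nat.zero_le _)).1] at hj
    rw [hj]
    simp only [Pi.add_apply, Finset.sum_apply, Pi.smul_apply, Pi.sub_apply, smul_eq_mul]
    congr 1
    refine Finset.sum_congr rfl fun i hi => ?_
    have hi := Finset.mem_range.mp hi
    rw [(hz _ (by omega)).1, (hz i (by omega)).1]
  refine ⟨p, g, c, hgA _ hp, fun i hi => ?_, fun i hi => hgmono i (by omega), fun x' => ?_⟩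
  · refine Finset.mem_erase.mpr ⟨fun h => ?_, hgA i (by omega)⟩
    have := hginj i (by omega) (p + 1) hp h
    omega
  · conv_lhs => rw [hgc]
    simp only [ip_eq_dotProduct, dotProduct_add, dotProduct_sum, dotProduct_smul, smul_eq_mul]

lemma exists_infers_of_pos {n w k : ℕ} (hw : 0 < w) (hk : 0 < k)
    (hcard : 6 * (2 * w * k + 1) < 2 ^ k) (hn : 0 < n) {S A : Finset (Fin n → ℝ)}
    (hAS : A ⊆ S) (hA : A ⊆ L1Ball n w) (hAc : n * k < A.card) (x : Fin n → ℝ)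
    (hx : ∀ h ∈ A, 0 < ip x h) : ∃ h ∈ S, Infers (S.erase h) x h := by
  obtain ⟨p, g, c, hpA, hgA, hmono, hc⟩ := exists_sorted_combination hw hk hcard hn hA hAc x
  have hgS : ∀ i ≤ p, g i ∈ S.erase (g (p + 1)) := fun i hi =>
    Finset.erase_subset_erase _ hAS (hgA i hi)
  refine ⟨g (p + 1), hAS hpA, fun x' h1 h2 => ?_⟩
  rw [sign_pos (hx _ hpA), sign_eq_one_iff, hc x']
  have h0 : 0 < ip x' (g 0) := by
    rw [← sign_eq_one_iff, h1 _ (hgS 0 (Nat.zero_le _)), sign_eq_one_iff]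
    exact hx _ (Finset.mem_of_mem_erase (hgA 0 (Nat.zero_le _)))
  refine add_pos_of_pos_of_nonneg h0 (Finset.sum_nonneg fun i hi => ?_)
  have hi := Finset.mem_range.mp hi
  refine mul_nonneg (Nat.cast_nonneg _) ?_
  rw [← sign_nonneg_iff, h2 _ (hgS _ hi) _ (hgS i hi.le), sign_nonneg_iff, ip_sub]
  linarith [hmono i hi]

lemma exists_infers_of_eq_zero {n w k : ℕ} (hw : 0 < w) (hk : 0 < k)
    (hcard : 6 * (2 * w * k + 1) < 2 ^ k) (hn : 0 < n) {S A : Finset (Fin n → ℝ)}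
    (hAS : A ⊆ S) (hA : A ⊆ L1Ball n w) (hAc : n * k < A.card) (x : Fin n → ℝ)
    (hx : ∀ h ∈ A, ip x h = 0) : ∃ h ∈ S, Infers (S.erase h) x h := by
  obtain ⟨p, g, c, hpA, hgA, -, hc⟩ := exists_sorted_combination hw hk hcard hn hA hAc x
  refine ⟨g (p + 1), hAS hpA, fun x' h1 _ => ?_⟩
  have hzero : ∀ i ≤ p, ip x' (g i) = 0 := fun i hi => by
    rw [← sign_eq_zero_iff, h1 _ (Finset.erase_subset_erase _ hAS (hgA i hi)), sign_eq_zero_iff]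
    exact hx _ (Finset.mem_of_mem_erase (hgA i hi))
  rw [hx _ hpA, hc x', hzero 0 (Nat.zero_le _), zero_add, Finset.sum_eq_zero]
  intro i hi
  have hi := Finset.mem_range.mp hi
  rw [ip_sub, hzero _ hi, hzero i hi.le, sub_zero, mul_zero]

lemma infProp_L1Ball {n w k : ℕ} (hw : 0 < w) (hk : 0 < k)
    (hcard : 6 * (2 * w * k + 1) < 2 ^ k) (hn : 0 < n) :
    InfProp (L1Ball n w) (3 * (n * k) + 1) := by
  intro S hS hSc x
  obtain ⟨s, -, hs⟩ := Finset.exists_lt_card_fiber_of_mul_lt_card_of_maps_to (s := S)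
    (t := (Finset.univ : Finset SignType)) (f := fun h => SignType.sign (ip x h)) (n := n * k)
    (fun _ _ => Finset.mem_univ _)
    (by rw [Finset.card_univ, show Fintype.card SignType = 3 from rfl]; omega)
  set A := S.filter (fun h => SignType.sign (ip x h) = s)
  have hAS : A ⊆ S := Finset.filter_subset _ _
  have hsign : ∀ h ∈ A, SignType.sign (ip x h) = s := fun h hh => (Finset.mem_filter.mp hh).2
  cases s with
  | zero =>
    exact exists_infers_of_eq_zero hw hk hcard hn hAS (hAS.trans hS) hs x
      fun h hh => sign_eq_zero_iff.mp (hsign h hh)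
  | pos =>
    exact exists_infers_of_pos hw hk hcard hn hAS (hAS.trans hS) hs x
      fun h hh => sign_eq_one_iff.mp (hsign h hh)
  | neg =>
    obtain ⟨h, hh, hinf⟩ := exists_infers_of_pos hw hk hcard hn hAS (hAS.trans hS) hs (-x)
      fun h hh => by
        rw [ip_neg_left]
        exact neg_pos.mpr (sign_eq_neg_one_iff.mp (hsign h hh))
    exact ⟨h, hh, hinf.of_neg⟩

lemma counting_bound {w L : ℕ} (hL : 0 < L) (hw : w < 2 ^ (L + 1)) :
    6 * (2 * w * (12 * L) + 1) < 2 ^ (12 * L) := by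
  have h1 : L < 2 ^ L := Nat.lt_two_pow_self
  have h2 : 2 ≤ 2 ^ L := by simpa using Nat.pow_le_pow_right (n := 2) (by norm_num) hL
  rw [pow_succ] at hw
  rw [mul_comm 12 L, pow_mul]
  generalize 2 ^ L = a at *
  have h3 : w * L ≤ 2 * a ^ 2 := by nlinarith
  have h4 : 2 ^ 10 * a ^ 2 ≤ a ^ 12 := by
    calc 2 ^ 10 * a ^ 2 ≤ a ^ 10 * a ^ 2 := by gcongr
      _ = a ^ 12 := by ring
  nlinarith

/-- Theorem 1.5: there is a universal constant `C > 0` such that for all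
`n ≥ 1` and `w ≥ 2`, the set `H = {h ∈ ℤ^n : ‖h‖₁ ≤ w}` has inference dimension at most
`C·n·log₂ w`, i.e. there is some `d ≥ 1` with `d ≤ C·n·log₂ w` such that every `S ⊆ H` with
`|S| ≥ d` contains, for every `x`, an element inferred by the rest of `S` at `x`. -/
theorem inference_dimension_L1Ball :
    ∃ C : ℝ, 0 < C ∧ ∀ n w : ℕ, 1 ≤ n → 2 ≤ w →
      ∃ d : ℕ, 1 ≤ d ∧ InfProp (L1Ball n w) d ∧ (d : ℝ) ≤ C * n * Real.logb 2 w := by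
  refine ⟨37, by norm_num, fun n w hn hw => ?_⟩
  set L := Nat.log 2 w with hL
  have hL0 : 0 < L := Nat.log_pos (by norm_num) hw
  refine ⟨3 * (n * (12 * L)) + 1, by omega, infProp_L1Ball (by omega) (by omega)
    (counting_bound hL0 (Nat.lt_pow_succ_log_self (by norm_num) w)) hn, ?_⟩
  have hlog : (L : ℝ) ≤ Real.logb 2 w := by
    simpa using Real.natLog_le_logb w 2
  have h1 : 1 ≤ n * L := Nat.mul_pos hn hL0
  calc ((3 * (n * (12 * L)) + 1 : ℕ) : ℝ) ≤ ((37 * n * L : ℕ) : ℝ) := by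
        exact_mod_cast (by linarith : 3 * (n * (12 * L)) + 1 ≤ 37 * n * L)
    _ = 37 * n * (L : ℝ) := by push_cast; ring
    _ ≤ 37 * n * Real.logb 2 w := by gcongr

end LDT
end

section
/- Let n, m, w ≥ 1 be integers and let h₁, …, h_m ∈ ℤ^n satisfy ‖h_i‖₁ ≤ w for all i. Then the set F := { Σ_{i=1}^{m−1} β_i (h_{i+1} − h_i) : β ∈ {0,1}^{m−1} } ⊆ ℤ^n has size |F| ≤ 2^n · binomial(2w(m−1)+n, n). -/
open Finset

namespace LDT

/-- Every integer vector of `ℓ¹`-norm at most `R` is determined by its signs and by the multiset,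
padded to size `R`, of its coordinates counted with their absolute values. -/
theorem card_le_of_sum_abs_le {n R : ℕ} (s : Finset (Fin n → ℤ))
    (hs : ∀ x ∈ s, ∑ j, |x j| ≤ (R : ℤ)) : s.card ≤ 2 ^ n * (R + n).choose n := by
  classical
  let f : (Fin n → Bool) × Sym (Option (Fin n)) R → Fin n → ℤ := fun p j =>
    bif p.1 j then -((p.2 : Multiset (Option (Fin n))).count (some j) : ℤ)
    else (p.2 : Multiset (Option (Fin n))).count (some j)
  have hsub : s ⊆ univ.image f := by
    intro x hx
    have hR : ∑ j, (x j).natAbs ≤ R := by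
      have := hs x hx
      zify
      exact this
    let t : Multiset (Option (Fin n)) :=
      Multiset.replicate (R - ∑ j, (x j).natAbs) none +
        ∑ j, Multiset.replicate (x j).natAbs (some j)
    have ht : t.card = R := by
      simp only [t, Multiset.card_add, Multiset.card_replicate, Multiset.card_sum]
      omega
    have hcount (j : Fin n) : t.count (some j) = (x j).natAbs := by
      simp [t, Multiset.count_sum', Multiset.count_replicate]
    refine mem_image.2 ⟨(fun j => decide (x j < 0), ⟨t, ht⟩), mem_univ _, funext fun j => ?_⟩
    change (bif decide (x j < 0) then -(t.count (some j) : ℤ) else (t.count (some j) : ℤ)) = x j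
    rw [hcount]
    by_cases hj : x j < 0
    · simp only [hj, decide_true, cond_true]
      omega
    · simp only [hj, decide_false, cond_false]
      omega
  calc s.card ≤ (univ.image f).card := card_le_card hsub
    _ ≤ Fintype.card ((Fin n → Bool) × Sym (Option (Fin n)) R) := card_image_le
    _ = 2 ^ n * (R + n).choose n := by
      rw [Fintype.card_prod, Sym.card_sym_eq_choose]
      have e : n + 1 + R - 1 = R + n := by omega
      simp [e, Nat.choose_symm_add]

/-- counting bound inside Claim 3.2: for `h 0, …, h (m-1) ∈ ℤ^n` with
`‖h i‖₁ ≤ w`, the set `F = {∑_{i<m-1} β i • (h (i+1) - h i) : β ∈ {0,1}^(m-1)}` has size at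
most `2^n · C(2w(m-1)+n, n)`. -/
theorem count_subset_sums (n m w : ℕ) (hn : 1 ≤ n) (hm : 1 ≤ m) (hw : 1 ≤ w)
    (h : ℕ → Fin n → ℤ) (hl1 : ∀ i < m, ∑ j, |h i j| ≤ (w : ℤ)) :
    ((Fintype.piFinset (fun _ : Fin (m - 1) => ({0, 1} : Finset ℤ))).image
        (fun β => ∑ i : Fin (m - 1), β i • (h ((i : ℕ) + 1) - h (i : ℕ)))).card
      ≤ 2 ^ n * Nat.choose (2 * w * (m - 1) + n) n := by
  refine card_le_of_sum_abs_le _ fun x hx => ?_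
  obtain ⟨β, hβ, rfl⟩ := mem_image.1 hx
  have hterm (i : Fin (m - 1)) :
      ∑ j, |(β i • (h ((i : ℕ) + 1) - h (i : ℕ))) j| ≤ 2 * (w : ℤ) := by
    have hβi : |β i| ≤ 1 := by
      have := Fintype.mem_piFinset.1 hβ i
      rcases mem_insert.1 this with h0 | h1
      · simp [h0]
      · simp [mem_singleton.1 h1]
    calc ∑ j, |(β i • (h ((i : ℕ) + 1) - h (i : ℕ))) j|
        ≤ ∑ j, (|h ((i : ℕ) + 1) j| + |h (i : ℕ) j|) := by
          refine sum_le_sum fun j _ => ?_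
          rw [Pi.smul_apply, Pi.sub_apply, smul_eq_mul, abs_mul]
          exact (mul_le_of_le_one_left (abs_nonneg _) hβi).trans (abs_sub _ _)
      _ ≤ 2 * (w : ℤ) := by
          rw [sum_add_distrib]
          have h₁ := hl1 ((i : ℕ) + 1) (by omega)
          have h₂ := hl1 (i : ℕ) (by omega)
          linarith
  calc ∑ j, |(∑ i : Fin (m - 1), β i • (h ((i : ℕ) + 1) - h (i : ℕ))) j|
      ≤ ∑ j, ∑ i : Fin (m - 1), |(β i • (h ((i : ℕ) + 1) - h (i : ℕ))) j| := by
        refine sum_le_sum fun j _ => ?_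
        rw [Finset.sum_apply]
        exact abs_sum_le_sum_abs _ _
    _ = ∑ i : Fin (m - 1), ∑ j, |(β i • (h ((i : ℕ) + 1) - h (i : ℕ))) j| := sum_comm
    _ ≤ ∑ _i : Fin (m - 1), 2 * (w : ℤ) := sum_le_sum fun i _ => hterm i
    _ = ((2 * w * (m - 1) : ℕ) : ℤ) := by
        rw [sum_const, card_univ, Fintype.card_fin, nsmul_eq_mul]
        push_cast
        ring

end LDT
end

section
/- Let S ⊆ ℝ^n be a finite set of size |S| = d + m, where every subset S′ ⊆ S with |S′| ≥ d satisfies: for every x ∈ ℝ^n there is h ∈ S′ with h ∈ infer(S′∖{h}, x) (in particular this holds if S is contained in a set of inference dimension d). Then for every x ∈ ℝ^n there exist m distinct elements h₁, …, h_m ∈ S such that h_i ∈ infer(S ∖ {h_i}, x) for every i = 1, …, m. -/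
open Finset

namespace LDT

/-- A larger set infers everything that a smaller one does. -/
theorem Infers.mono {n : ℕ} {S T : Finset (Fin n → ℝ)} {x h : Fin n → ℝ} (hST : S ⊆ T)
    (hS : Infers S x h) : Infers T x h :=
  fun x' h₁ h₂ => hS x' (fun v hv => h₁ v (hST hv))
    (fun v hv w hw => h₂ v (hST hv) w (hST hw))

/-- Claim 4.1: if `S` has size `d + m` and every subset `S' ⊆ S` with
`|S'| ≥ d` contains, for every `x`, an element inferred by the rest of `S'` at `x` (which holds
in particular if `S` is contained in a set of inference dimension `d`), then for every `x` there
are `m` distinct elements of `S`, each inferred by `S` minus that element at `x`. -/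
theorem iterated_inference {n : ℕ} (d m : ℕ) (S : Finset (Fin n → ℝ))
    (hcard : S.card = d + m)
    (hinf : ∀ S' ⊆ S, d ≤ S'.card → ∀ x : Fin n → ℝ, ∃ h ∈ S', Infers (S'.erase h) x h) :
    ∀ x : Fin n → ℝ, ∃ T ⊆ S, T.card = m ∧ ∀ h ∈ T, Infers (S.erase h) x h := by
  intro x
  induction m generalizing S with
  | zero => exact ⟨∅, by simp⟩
  | succ m ih =>
    obtain ⟨h, hh, hI⟩ := hinf S Subset.rfl (by omega) x
    obtain ⟨T, hTS, hT, hTI⟩ := ih (S.erase h) (by rw [card_erase_of_mem hh]; omega)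
      (fun S' hS' => hinf S' (hS'.trans (erase_subset h S)))
    refine ⟨insert h T, insert_subset hh (hTS.trans (erase_subset h S)), ?_, ?_⟩
    · rw [card_insert_of_notMem (fun hm => notMem_erase h S (hTS hm)), hT]
    · intro k hk
      rcases mem_insert.1 hk with rfl | hk
      · exact hI
      · exact (hTI k hk).mono (erase_subset_erase k (erase_subset h S))

end LDT
end

section
/- Let H ⊆ ℝ^n be a finite set with inference dimension d, and suppose 2d ≤ |H|. Then for every x ∈ ℝ^n, the number of subsets S ⊆ H of size |S| = 2d satisfying |infer(S,x) ∩ H| ≥ |H|/4 is at least (1/4)·binomial(|H|, 2d). -/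
open Finset

namespace LDT

theorem infers_of_mem {n : ℕ} {S : Finset (Fin n → ℝ)} {x h : Fin n → ℝ} (hh : h ∈ S) :
    Infers S x h :=
  fun _ h₁ _ => h₁ h hh

open scoped Classical

/-- All but fewer than `d` elements of `T ⊆ H` are inferred by the other elements of `T`. -/
theorem InfProp.card_le_card_filter_infers_add {n : ℕ} {H T : Finset (Fin n → ℝ)} {d : ℕ}
    (hdim : InfProp H d) (hT : T ⊆ H) (x : Fin n → ℝ) :
    T.card ≤ (T.filter fun h => Infers (T.erase h) x h).card + d := by
  have hsplit := T.card_filter_add_card_filter_not (fun h => Infers (T.erase h) x h)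
  by_contra! hlt
  obtain ⟨h, hmem, hinf⟩ := hdim (T.filter fun h => ¬ Infers (T.erase h) x h)
    ((filter_subset _ _).trans hT) (by omega) x
  exact (mem_filter.1 hmem).2 (hinf.mono (erase_subset_erase _ (filter_subset _ _)))

/-- Moving an element out of a `(k + 1)`-set gives a `k`-set together with an outside element. -/
theorem sum_card_filter_erase_le {α : Type*} [DecidableEq α] (H : Finset α) (k : ℕ)
    (P : Finset α → α → Prop) :
    ∑ T ∈ H.powersetCard (k + 1), (T.filter fun h => P (T.erase h) h).card ≤
      ∑ S ∈ H.powersetCard k, ((H \ S).filter fun h => P S h).card := by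
  rw [← card_sigma, ← card_sigma]
  refine card_le_card_of_injOn (fun p => ⟨p.1.erase p.2, p.2⟩) ?_ ?_
  · rintro ⟨T, h⟩ hp
    simp only [coe_sigma, Set.mem_sigma_iff, mem_coe, mem_powersetCard, mem_filter, mem_sdiff]
      at hp ⊢
    obtain ⟨⟨hTH, hcard⟩, hhT, hP⟩ := hp
    exact ⟨⟨(erase_subset _ _).trans hTH, by rw [card_erase_of_mem hhT, hcard]; rfl⟩,
      ⟨hTH hhT, notMem_erase _ _⟩, hP⟩
  · rintro ⟨T, h⟩ hp ⟨T', h'⟩ hp' heq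
    simp only [coe_sigma, Set.mem_sigma_iff, mem_coe, mem_filter] at hp hp'
    simp only [Sigma.mk.injEq, heq_eq_eq] at heq
    obtain ⟨hT, rfl⟩ := heq
    rw [← insert_erase hp.2.1, hT, insert_erase hp'.2.1]

/-- On average, a `2d`-subset of `H` infers at least half of `H`. -/
theorem InfProp.choose_mul_card_le {n : ℕ} {H : Finset (Fin n → ℝ)} {d : ℕ}
    (hdim : InfProp H d) (hH : 2 * d ≤ H.card) (x : Fin n → ℝ) :
    H.card.choose (2 * d) * H.card ≤
      2 * ∑ S ∈ H.powersetCard (2 * d), (H.filter fun h => Infers S x h).card := by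
  have hlower : H.card.choose (2 * d + 1) * (d + 1) ≤
      ∑ S ∈ H.powersetCard (2 * d), ((H \ S).filter fun h => Infers S x h).card := by
    refine le_trans ?_ (sum_card_filter_erase_le H (2 * d) fun S h => Infers S x h)
    rw [← card_powersetCard, ← smul_eq_mul]
    refine card_nsmul_le_sum _ _ _ fun T hT => ?_
    obtain ⟨hTH, hcard⟩ := mem_powersetCard.1 hT
    have := hdim.card_le_card_filter_infers_add hTH x
    omega
  have hsplit : ∀ S ∈ H.powersetCard (2 * d), (H.filter fun h => Infers S x h).card =
      ((H \ S).filter fun h => Infers S x h).card + 2 * d := by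
    intro S hS
    obtain ⟨hSH, hcard⟩ := mem_powersetCard.1 hS
    have hS' : S.filter (fun h => Infers S x h) = S :=
      filter_true_of_mem fun h hh => infers_of_mem hh
    conv_lhs => rw [← sdiff_union_of_subset hSH, filter_union, hS']
    rw [card_union_of_disjoint (disjoint_sdiff_self_left.mono_left (filter_subset _ _)), hcard]
  rw [sum_congr rfl hsplit, sum_add_distrib, sum_const, card_powersetCard, smul_eq_mul]
  have hchoose := Nat.choose_succ_right_eq H.card (2 * d)
  obtain ⟨r, hr⟩ := Nat.exists_eq_add_of_le hH
  have hsub : H.card - 2 * d = r := by omega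
  rw [hsub] at hchoose
  have hmul : H.card.choose (2 * d) * H.card =
      H.card.choose (2 * d) * (2 * d) + H.card.choose (2 * d) * r := by
    rw [← mul_add, ← hr]
  nlinarith

/-- Corollary 5.1: if `H` has inference dimension `d` and `2d ≤ |H|`, then for
every `x`, at least a quarter of the subsets `S ⊆ H` of size `2d` satisfy
`|infer(S,x) ∩ H| ≥ |H|/4`. -/
theorem many_good_subsets {n : ℕ} (H : Finset (Fin n → ℝ)) (d : ℕ) (hd : 1 ≤ d)
    (hdim : InfProp H d) (hH : 2 * d ≤ H.card) (x : Fin n → ℝ) :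
    ((1 : ℝ) / 4) * (H.card.choose (2 * d)) ≤
      (((H.powersetCard (2 * d)).filter
          (fun S => (H.card : ℝ) / 4 ≤ ((H.filter (fun h => Infers S x h)).card : ℝ))).card : ℝ) := by
  set m : ℝ := (H.card : ℝ) with hm
  have hmpos : 0 < m := by rw [hm]; exact_mod_cast (by omega : 0 < H.card)
  have haverage : (H.card.choose (2 * d) : ℝ) * m ≤
      2 * ∑ S ∈ H.powersetCard (2 * d), ((H.filter fun h => Infers S x h).card : ℝ) := by
    rw [hm]
    exact_mod_cast hdim.choose_mul_card_le hH x
  have hupper : ∑ S ∈ H.powersetCard (2 * d), ((H.filter fun h => Infers S x h).card : ℝ) ≤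
      ∑ S ∈ H.powersetCard (2 * d),
        (m / 4 + if m / 4 ≤ ((H.filter fun h => Infers S x h).card : ℝ) then m else 0) := by
    refine sum_le_sum fun S _ => ?_
    split_ifs with hS
    · have : ((H.filter fun h => Infers S x h).card : ℝ) ≤ m := by
        rw [hm]; exact_mod_cast card_filter_le _ _
      linarith
    · linarith
  rw [sum_add_distrib, sum_const, card_powersetCard, nsmul_eq_mul, ← sum_filter, sum_const,
    nsmul_eq_mul] at hupper
  refine le_of_mul_le_mul_right ?_ hmpos
  linarith

end LDT
end

section
/- There is a universal constant c > 0 such that the following holds. Let H ⊆ ℝ^n be a finite set, let T ⊆ H with |T| = 2d, and let x ∈ ℝ^n satisfy |infer(T,x) ∩ (H∖T)| ≤ |H∖T|/8. Let s be an integer with 10·|T| ≤ s ≤ |H|. Then the fraction of sets S with T ⊆ S ⊆ H and |S| = s (chosen uniformly among all such sets) that satisfy |infer(T,x) ∩ S| ≥ |S|/4 is at most 2^{−c·s}. -/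
open Finset

namespace LDT

/-- If `b ≤ p * N` with `0 ≤ p ≤ 1`, then the ratio of the binomial coefficients `b.choose a` and
`N.choose a` is at most `p ^ a`. -/
lemma choose_le_choose_mul_pow {b N : ℕ} {p : ℝ} (hp0 : 0 ≤ p) (hp1 : p ≤ 1)
    (h : (b : ℝ) ≤ p * N) (a : ℕ) : (b.choose a : ℝ) ≤ N.choose a * p ^ a := by
  have hbN : b ≤ N := by
    have : (b : ℝ) ≤ N := h.trans (mul_le_of_le_one_left (by positivity) hp1)
    exact_mod_cast this
  induction a with
  | zero => simp
  | succ a ih =>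
    rcases lt_or_ge b a with hab | hab
    · rw [Nat.choose_eq_zero_of_lt (by omega)]
      simp only [Nat.cast_zero]
      positivity
    · have e1 : (b.choose (a + 1) : ℝ) * (a + 1) = b.choose a * (b - a) := by
        rw [← Nat.cast_sub hab]
        exact_mod_cast Nat.choose_succ_right_eq b a
      have e2 : (N.choose (a + 1) : ℝ) * (a + 1) = N.choose a * (N - a) := by
        rw [← Nat.cast_sub (hab.trans hbN)]
        exact_mod_cast Nat.choose_succ_right_eq N a
      have hba : (b : ℝ) - a ≤ p * (N - a) := by nlinarith [(Nat.cast_nonneg a : (0 : ℝ) ≤ a)]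
      have hba0 : (0 : ℝ) ≤ b - a := by
        rw [← Nat.cast_sub hab]
        positivity
      refine le_of_mul_le_mul_right ?_ (by positivity : (0 : ℝ) < a + 1)
      calc (b.choose (a + 1) : ℝ) * (a + 1) = b.choose a * (b - a) := e1
        _ ≤ (N.choose a * p ^ a) * (p * (N - a)) := by gcongr
        _ = (N.choose a * (N - a)) * p ^ (a + 1) := by ring
        _ = N.choose (a + 1) * p ^ (a + 1) * (a + 1) := by rw [← e2]; ring

/-- Moment generating function bound for the hypergeometric distribution: it is dominated by that
of the binomial distribution. -/
lemma sum_powersetCard_pow_card_inter_le {α : Type*} [DecidableEq α] {U B : Finset α}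
    (hBU : B ⊆ U) (m : ℕ) {p t : ℝ} (hp0 : 0 ≤ p) (hp1 : p ≤ 1) (ht : 0 ≤ t)
    (h : (#B : ℝ) ≤ p * #U) :
    ∑ R ∈ U.powersetCard m, (1 + t) ^ #(R ∩ B) ≤ (#U).choose m * (1 + t * p) ^ m := by
  have expand (R : Finset α) :
      (1 + t) ^ #(R ∩ B) = ∑ A ∈ B.powerset, if A ⊆ R then t ^ #A else 0 := by
    rw [← sum_filter, ← prod_const, prod_one_add]
    refine sum_congr ?_ fun A _ => prod_const t
    ext A
    simp only [mem_powerset, mem_filter, subset_inter_iff, and_comm]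
  have count (A : Finset α) (hA : A ∈ B.powerset) :
      ∑ R ∈ U.powersetCard m, (if A ⊆ R then t ^ #A else 0) ≤
        if #A ≤ m then t ^ #A * (#U - #A).choose (m - #A) else 0 := by
    rw [← sum_filter, sum_const, nsmul_eq_mul]
    split_ifs with hAm
    · rw [card_filter_powersetCard_subset _ _ _ ((mem_powerset.1 hA).trans hBU) hAm, mul_comm]
    · rw [filter_false_of_mem]
      · simp
      · intro R hR hAR
        exact hAm ((card_le_card hAR).trans (mem_powersetCard.1 hR).2.le)
  have bound (a : ℕ) (ha : a ≤ m) :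
      (#B).choose a * (t ^ a * (#U - a).choose (m - a)) ≤
        (#U).choose m * ((t * p) ^ a * (m.choose a : ℝ)) := by
    have e : ((#U).choose m : ℝ) * m.choose a = (#U).choose a * (#U - a).choose (m - a) := by
      exact_mod_cast Nat.choose_mul ha
    calc ((#B).choose a : ℝ) * (t ^ a * (#U - a).choose (m - a))
        ≤ ((#U).choose a * p ^ a) * (t ^ a * (#U - a).choose (m - a)) := by
          gcongr
          exact choose_le_choose_mul_pow hp0 hp1 h a
      _ = ((#U).choose a * (#U - a).choose (m - a)) * (t * p) ^ a := by rw [mul_pow]; ring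
      _ = (#U).choose m * ((t * p) ^ a * (m.choose a : ℝ)) := by rw [← e]; ring
  calc ∑ R ∈ U.powersetCard m, (1 + t) ^ #(R ∩ B)
      = ∑ A ∈ B.powerset, ∑ R ∈ U.powersetCard m, if A ⊆ R then t ^ #A else 0 := by
        rw [sum_comm]
        exact sum_congr rfl fun R _ => expand R
    _ ≤ ∑ A ∈ B.powerset, if #A ≤ m then t ^ #A * (#U - #A).choose (m - #A) else 0 :=
        sum_le_sum count
    _ = ∑ a ∈ range (#B + 1),
          if a ≤ m then (#B).choose a * (t ^ a * (#U - a).choose (m - a)) else 0 := by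
        rw [sum_powerset_apply_card
          (fun a => if a ≤ m then t ^ a * ((#U - a).choose (m - a) : ℝ) else 0)]
        refine sum_congr rfl fun a _ => ?_
        rw [nsmul_eq_mul, mul_ite, mul_zero]
    _ = ∑ a ∈ range (#B + 1) with a ≤ m, (#B).choose a * (t ^ a * (#U - a).choose (m - a)) :=
        (sum_filter _ _).symm
    _ ≤ ∑ a ∈ range (m + 1), (#B).choose a * (t ^ a * (#U - a).choose (m - a)) := by
        refine sum_le_sum_of_subset_of_nonneg ?_ fun a _ _ => by positivity
        intro a ha
        exact mem_range.2 (Nat.lt_succ_of_le (mem_filter.1 ha).2)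
    _ ≤ ∑ a ∈ range (m + 1), (#U).choose m * ((t * p) ^ a * (m.choose a : ℝ)) :=
        sum_le_sum fun a ha => bound a (Nat.lt_succ_iff.1 (mem_range.1 ha))
    _ = (#U).choose m * (1 + t * p) ^ m := by
        rw [← mul_sum, add_comm 1, add_pow]
        simp

/-- Chernoff bound for the upper tail of the hypergeometric distribution. -/
lemma card_powersetCard_filter_mul_rpow_le {α : Type*} [DecidableEq α] {U B : Finset α}
    (hBU : B ⊆ U) (m : ℕ) {p t r : ℝ} (hp0 : 0 ≤ p) (hp1 : p ≤ 1) (ht : 0 ≤ t)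
    (h : (#B : ℝ) ≤ p * #U) :
    (#{R ∈ U.powersetCard m | r ≤ (#(R ∩ B) : ℝ)} : ℝ) * (1 + t) ^ r ≤
      (#U).choose m * (1 + t * p) ^ m := by
  refine le_trans ?_ (sum_powersetCard_pow_card_inter_le hBU m hp0 hp1 ht h)
  rw [← nsmul_eq_mul]
  refine (card_nsmul_le_sum _ (fun R => (1 + t) ^ #(R ∩ B)) _ fun R hR => ?_).trans
    (sum_le_sum_of_subset_of_nonneg (filter_subset _ _) fun R _ _ => by positivity)
  rw [← Real.rpow_natCast]
  exact Real.rpow_le_rpow_of_exponent_le (by linarith) (mem_filter.1 hR).2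

open scoped Classical

/-- Chernoff-type claim: there is a universal `c > 0` such that if `T ⊆ H`
with `|T| = 2d`, `x` satisfies `|infer(T,x) ∩ (H∖T)| ≤ |H∖T|/8`, and `10·|T| ≤ s ≤ |H|`, then
among all sets `S` with `T ⊆ S ⊆ H` and `|S| = s`, the fraction satisfying
`|infer(T,x) ∩ S| ≥ |S|/4` is at most `2^(-c·s)`. -/
theorem chernoff_fraction :
    ∃ c : ℝ, 0 < c ∧
      ∀ (n : ℕ) (H T : Finset (Fin n → ℝ)) (d s : ℕ) (x : Fin n → ℝ),
        T ⊆ H → T.card = 2 * d →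
        (((H \ T).filter (fun h => Infers T x h)).card : ℝ) ≤ ((H \ T).card : ℝ) / 8 →
        10 * T.card ≤ s → s ≤ H.card →
        ((((H.powersetCard s).filter
            (fun S => T ⊆ S ∧
              (s : ℝ) / 4 ≤ ((S.filter (fun h => Infers T x h)).card : ℝ))).card : ℝ)
          / ((H.card - 2 * d).choose (s - 2 * d)))
          ≤ (2 : ℝ) ^ (-(c * s)) := by
  set q : ℝ := (5 / 4 : ℝ) ^ (3 / 20 : ℝ) * (32 / 33) with hq
  have hq1 : 1 < q := by
    have : (33 / 32 : ℝ) < (5 / 4 : ℝ) ^ (3 / 20 : ℝ) := by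
      refine lt_of_pow_lt_pow_left₀ 20 (by positivity) ?_
      rw [← Real.rpow_natCast ((5 / 4 : ℝ) ^ (3 / 20 : ℝ)), ← Real.rpow_mul (by norm_num)]
      norm_num
    rw [hq]
    linarith
  refine ⟨Real.logb 2 q, Real.logb_pos one_lt_two hq1, ?_⟩
  intro n H T d s x hTH hT hB hs hsH
  set U := H \ T with hU
  set B := U.filter (fun h => Infers T x h) with hBdef
  have hUcard : #U = #H - 2 * d := by rw [hU, card_sdiff_of_subset hTH, hT]
  have hrhs : (2 : ℝ) ^ (-(Real.logb 2 q * s)) = (q ^ s)⁻¹ := by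
    rw [Real.rpow_neg two_pos.le, Real.rpow_mul two_pos.le,
      Real.rpow_logb two_pos (by norm_num) (by linarith), Real.rpow_natCast]
  have hinj : #{S ∈ H.powersetCard s |
        T ⊆ S ∧ (s : ℝ) / 4 ≤ (#(S.filter (fun h => Infers T x h)) : ℝ)} ≤
      #{R ∈ U.powersetCard (s - 2 * d) | 3 / 20 * (s : ℝ) ≤ (#(R ∩ B) : ℝ)} := by
    refine card_le_card_of_injOn (· \ T) ?_ ?_
    · intro S hS
      simp only [coe_filter, mem_powersetCard, Set.mem_ofPred_eq] at hS ⊢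
      obtain ⟨⟨hSH, hSs⟩, hTS, hS4⟩ := hS
      refine ⟨⟨sdiff_subset_sdiff hSH le_rfl, by rw [card_sdiff_of_subset hTS, hSs, hT]⟩, ?_⟩
      have hsub : S.filter (fun h => Infers T x h) ⊆ T ∪ (S \ T ∩ B) := by
        intro h hh
        have := hSH (mem_filter.1 hh).1
        simp only [mem_filter, mem_union, mem_inter, mem_sdiff, hBdef, hU] at hh ⊢
        tauto
      have hcard : (#(S.filter (fun h => Infers T x h)) : ℝ) ≤ #T + #(S \ T ∩ B) := by
        exact_mod_cast (card_le_card hsub).trans (card_union_le _ _)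
      have hs' : 10 * (#T : ℝ) ≤ s := by exact_mod_cast hs
      linarith
    · intro S hS S' hS' hSS
      simp only [coe_filter, Set.mem_ofPred_eq] at hS hS'
      rw [← sdiff_union_of_subset hS.2.1, ← sdiff_union_of_subset hS'.2.1]
      exact congrArg (· ∪ T) hSS
  have htail := card_powersetCard_filter_mul_rpow_le (filter_subset _ _ : B ⊆ U) (s - 2 * d)
    (p := 1 / 8) (t := 1 / 4) (r := 3 / 20 * s) (by norm_num) (by norm_num) (by norm_num)
    (by linarith)
  have hpow : (1 + 1 / 4 * (1 / 8) : ℝ) ^ (s - 2 * d) ≤ (33 / 32) ^ s := by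
    norm_num only
    exact pow_le_pow_right₀ (by norm_num) (Nat.sub_le _ _)
  have hqs : (1 + 1 / 4 : ℝ) ^ (3 / 20 * (s : ℝ)) = q ^ s * (33 / 32) ^ s := by
    rw [hq, ← mul_pow, mul_assoc, Real.rpow_mul (by norm_num), Real.rpow_natCast]
    norm_num
  rw [hrhs, ← hUcard]
  refine div_le_of_le_mul₀ (by positivity) (by positivity) ?_
  rw [inv_mul_eq_div, le_div_iff₀ (by positivity)]
  refine le_of_mul_le_mul_right ?_ (by positivity : (0 : ℝ) < (33 / 32) ^ s)
  rw [mul_assoc, ← hqs]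
  calc _ ≤ _ := mul_le_mul_of_nonneg_right (Nat.cast_le.2 hinj) (by positivity)
    _ ≤ _ := htail
    _ ≤ _ := by gcongr

end LDT
end
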